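/- There exists N such that for every integer n ≥ N with n not congruent to 3, 5, 24, or 26 (mod 28), the number NC(6n+3, 3) of isomorphism classes of cyclic Steiner triple systems of order 6n+3 satisfies NC(6n+3, 3) ≥ 2.49^n. -/

import Mathlib

namespace CCS

/-- A block: a set of edges of the complete graph on `ZMod v`. -/
abbrev Block (v : ℕ) := Finset (Sym2 (ZMod v))

/-- The edge set of the closed tuple `c = (c 0, c 1, …, c (k-1))`. -/
def edgesOf {v k : ℕ} (c : Fin k → ZMod v) : Block v :=
  Finset.image (fun i : Fin k => s(c i, c ⟨(i.1 + 1) % k, Nat.mod_lt _ i.pos⟩)) Finset.univ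

/-- `E` is the edge set of a `k`-cycle on `ZMod v`. Since for `k ≥ 3` the edge set
determines the closed tuple up to rotation and reversal, a `k`-cycle is identified
with its edge set. -/
def IsCycleBlock (v k : ℕ) (E : Block v) : Prop :=
  ∃ c : Fin k → ZMod v, Function.Injective c ∧ E = edgesOf c

/-- The translate `E + z` of a cycle. -/
def translateBlock {v : ℕ} (E : Block v) (z : ZMod v) : Block v :=
  E.image (Sym2.map (· + z))

/-- A `(K_v, C_k)`-design: a set of `k`-cycles whose edge sets partition the edges of `K_v`. -/
def IsDesign (v k : ℕ) (B : Set (Block v)) : Prop :=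
  (∀ E ∈ B, IsCycleBlock v k E) ∧
  ∀ e : Sym2 (ZMod v), ¬ e.IsDiag → ∃! E, E ∈ B ∧ e ∈ E

/-- A cyclic `(K_v, C_k)`-design. -/
def IsCyclicDesign (v k : ℕ) (B : Set (Block v)) : Prop :=
  IsDesign v k B ∧ ∀ E ∈ B, ∀ z : ZMod v, translateBlock E z ∈ B

/-- Two designs are isomorphic if a bijection of `ZMod v` maps one onto the other. -/
def Isomorphic {v : ℕ} (B B' : Set (Block v)) : Prop :=
  ∃ f : ZMod v ≃ ZMod v, B' = (fun E : Block v => E.image (Sym2.map f)) '' B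

/-- `NC v k`: the number of cyclic `(K_v, C_k)`-designs up to isomorphism. -/
noncomputable def NC (v k : ℕ) : ℕ :=
  Nat.card (Quot fun B B' : {B : Set (Block v) // IsCyclicDesign v k B} =>
    Isomorphic B.1 B'.1)

/-- The type of a cycle: the order of its stabilizer under translations. -/
noncomputable def cycleType {v : ℕ} (E : Block v) : ℕ :=
  Nat.card {z : ZMod v // translateBlock E z = E}

/-- The two differences `±(a-b)` arising from an edge `{a,b}`. -/
def edgeDiffs {v : ℕ} : Sym2 (ZMod v) → Multiset (ZMod v) :=
  Sym2.lift ⟨fun a b => {a - b, b - a}, fun a b => by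
    show (a-b) ::ₘ {b-a} = (b-a) ::ₘ {a-b}; exact Multiset.cons_swap _ _ _⟩

/-- The multiset of the `2k` differences arising from the `k` edges of a cycle.
For a cycle of type `d` this is `d` copies of the list `∂C` of partial differences. -/
def fullDiffs {v : ℕ} (E : Block v) : Multiset (ZMod v) :=
  E.val.bind edgeDiffs

/-- The multiset `∂C` of partial differences of a cycle: each difference is counted
with multiplicity equal to its multiplicity among the `2k` edge differences divided
by the type of the cycle. -/
noncomputable def partialDiffs {v : ℕ} (E : Block v) : Multiset (ZMod v) :=
  (fullDiffs E).toFinset.val.bind fun x =>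
    Multiset.replicate ((fullDiffs E).count x / cycleType E) x

/-- A `(K_v, C_k)`-difference system: a set of `k`-cycles whose partial differences
cover every nonzero element of `ZMod v` exactly once. -/
def IsDifferenceSystem (v k : ℕ) (F : Finset (Block v)) : Prop :=
  (∀ E ∈ F, IsCycleBlock v k E) ∧
  ∀ x : ZMod v, (F.val.bind partialDiffs).count x = if x = 0 then 0 else 1

end CCS

namespace CCS

section Triangles

variable {V : Type*} [DecidableEq V]

/-- The edge set of the triangle on `x, y, z`. -/
def tri (x y z : V) : Finset (Sym2 V) := {s(x, y), s(y, z), s(z, x)}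

lemma mem_tri {x y z : V} {e : Sym2 V} :
    e ∈ tri x y z ↔ e = s(x, y) ∨ e = s(y, z) ∨ e = s(z, x) := by
  simp [tri]

lemma tri_rotate (x y z : V) : tri x y z = tri y z x := by
  ext e; simp only [mem_tri]; tauto

lemma tri_swap (x y z : V) : tri x y z = tri y x z := by
  ext e
  simp only [mem_tri, Sym2.eq_swap (a := y) (b := x), Sym2.eq_swap (a := x) (b := z),
    Sym2.eq_swap (a := z) (b := y)]
  tauto

lemma image_tri {W : Type*} [DecidableEq W] (f : V → W) (x y z : V) :
    (tri x y z).image (Sym2.map f) = tri (f x) (f y) (f z) := by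
  simp [tri, Finset.image_insert]

lemma tri_right_injective {a b c d : V} (hab : a ≠ b) (hca : c ≠ a) (hcb : c ≠ b)
    (h : tri a b c = tri a b d) : c = d := by
  have h₁ : s(b, c) ∈ tri a b d := h ▸ mem_tri.2 (Or.inr (Or.inl rfl))
  simp only [mem_tri, Sym2.eq_iff] at h₁
  grind

lemma exists_tri_eq {a b x y z : V} (hxy : x ≠ y) (hyz : y ≠ z) (hzx : z ≠ x)
    (h : s(a, b) ∈ tri x y z) : ∃ c, c ≠ a ∧ c ≠ b ∧ tri x y z = tri a b c := by
  simp only [mem_tri, Sym2.eq_iff] at h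
  rcases h with (⟨rfl, rfl⟩ | ⟨rfl, rfl⟩) | (⟨rfl, rfl⟩ | ⟨rfl, rfl⟩) | (⟨rfl, rfl⟩ | ⟨rfl, rfl⟩)
  · exact ⟨z, hzx, hyz.symm, rfl⟩
  · exact ⟨z, hyz.symm, hzx, tri_swap _ _ _⟩
  · exact ⟨x, hxy, hzx.symm, tri_rotate _ _ _⟩
  · exact ⟨x, hzx.symm, hxy, by rw [tri_rotate, tri_swap]⟩
  · exact ⟨y, hyz, hxy.symm, by rw [tri_rotate, tri_rotate]⟩
  · exact ⟨y, hxy.symm, hyz, by rw [tri_rotate, tri_rotate, tri_swap]⟩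

end Triangles

lemma isCycleBlock_three_iff {v : ℕ} {E : Block v} :
    IsCycleBlock v 3 E ↔ ∃ x y z, x ≠ y ∧ y ≠ z ∧ z ≠ x ∧ E = tri x y z := by
  have key (c : Fin 3 → ZMod v) : edgesOf c = tri (c 0) (c 1) (c 2) := by
    ext e
    simp only [edgesOf, Finset.mem_image, Finset.mem_univ, true_and, mem_tri, Fin.exists_fin_succ]
    simp [eq_comm]
  constructor
  · rintro ⟨c, hc, rfl⟩
    exact ⟨c 0, c 1, c 2, hc.ne (by decide), hc.ne (by decide), hc.ne (by decide), key c⟩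
  · rintro ⟨x, y, z, hxy, hyz, hzx, rfl⟩
    refine ⟨![x, y, z], ?_, by simp [key]⟩
    intro i j hij
    fin_cases i <;> fin_cases j <;> simp_all

lemma exists_third {v : ℕ} {B : Set (Block v)} (hB : IsDesign v 3 B) {x y : ZMod v}
    (hxy : x ≠ y) : ∃ z, z ≠ x ∧ z ≠ y ∧ tri x y z ∈ B := by
  obtain ⟨E, ⟨hE, hxyE⟩, -⟩ := hB.2 s(x, y) (by simpa using hxy)
  obtain ⟨a, b, c, hab, hbc, hca, rfl⟩ := isCycleBlock_three_iff.1 (hB.1 E hE)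
  obtain ⟨z, hzx, hzy, h⟩ := exists_tri_eq hab hbc hca hxyE
  exact ⟨z, hzx, hzy, h ▸ hE⟩

lemma third_unique {v : ℕ} {B : Set (Block v)} (hB : IsDesign v 3 B) {x y z z' : ZMod v}
    (hxy : x ≠ y) (hzx : z ≠ x) (hzy : z ≠ y) (h : tri x y z ∈ B) (h' : tri x y z' ∈ B) :
    z = z' :=
  tri_right_injective hxy hzx hzy <|
    (hB.2 s(x, y) (by simpa using hxy)).unique ⟨h, mem_tri.2 (Or.inl rfl)⟩
      ⟨h', mem_tri.2 (Or.inl rfl)⟩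

section Automorphisms

variable {v : ℕ}

/-- The action of a permutation of the vertices on sets of blocks. -/
def mapBlocks (f : ZMod v ≃ ZMod v) (B : Set (Block v)) : Set (Block v) :=
  (fun E : Block v => E.image (Sym2.map f)) '' B

lemma mapBlocks_mapBlocks (f g : ZMod v ≃ ZMod v) (B : Set (Block v)) :
    mapBlocks g (mapBlocks f B) = mapBlocks (f.trans g) B := by
  simp only [mapBlocks, Set.image_image, Finset.image_image]
  congr! with E
  exact Sym2.map_comp.symm

lemma mapBlocks_refl (B : Set (Block v)) : mapBlocks (Equiv.refl _) B = B := by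
  simp [mapBlocks]

lemma tri_mem_mapBlocks {f : ZMod v ≃ ZMod v} {B : Set (Block v)} {x y z : ZMod v}
    (h : tri x y z ∈ B) : tri (f x) (f y) (f z) ∈ mapBlocks f B :=
  ⟨_, h, image_tri _ _ _ _⟩

lemma mapBlocks_addRight {B : Set (Block v)} (hB : IsCyclicDesign v 3 B) (z : ZMod v) :
    mapBlocks (Equiv.addRight z) B = B := by
  have hsub (z : ZMod v) : mapBlocks (Equiv.addRight z) B ⊆ B := by
    rintro _ ⟨E, hE, rfl⟩
    exact hB.2 E hE z
  have hcomp : mapBlocks (Equiv.addRight z) (mapBlocks (Equiv.addRight (-z)) B) = B := by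
    rw [mapBlocks_mapBlocks]
    convert mapBlocks_refl B
    ext x
    simp
  apply (hsub z).antisymm
  calc B = mapBlocks (Equiv.addRight z) (mapBlocks (Equiv.addRight (-z)) B) := hcomp.symm
    _ ⊆ _ := Set.image_mono (hsub (-z))

/-- The automorphisms of a set of blocks. -/
def autSet (B : Set (Block v)) : Set (ZMod v ≃ ZMod v) := {f | mapBlocks f B = B}

/-- The points fixed by every automorphism that fixes each point of `S`. -/
def fixedBy (B : Set (Block v)) (S : Finset (ZMod v)) : Set (ZMod v) :=
  {x | ∀ f ∈ autSet B, (∀ s ∈ S, f s = s) → f x = x}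

lemma subset_fixedBy (B : Set (Block v)) (S : Finset (ZMod v)) : (S : Set (ZMod v)) ⊆ fixedBy B S :=
  fun s hs _ _ h => h s hs

lemma fixedBy_mono (B : Set (Block v)) {S T : Finset (ZMod v)} (h : S ⊆ T) :
    fixedBy B S ⊆ fixedBy B T :=
  fun _ hx f hf hT => hx f hf fun s hs => hT s (h hs)

lemma fixedBy_closed {B : Set (Block v)} (hB : IsDesign v 3 B) {S : Finset (ZMod v)}
    {x y z : ZMod v} (hxy : x ≠ y) (hzx : z ≠ x) (hzy : z ≠ y) (h : tri x y z ∈ B)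
    (hx : x ∈ fixedBy B S) (hy : y ∈ fixedBy B S) : z ∈ fixedBy B S := by
  intro f hf hS
  have h' : tri x y (f z) ∈ B := by
    have := tri_mem_mapBlocks (f := f) h
    rwa [hf, hx f hf hS, hy f hf hS] at this
  exact (third_unique hB hxy hzx hzy h h').symm

lemma two_mul_ncard_fixedBy_le [NeZero v] {B : Set (Block v)} (hB : IsDesign v 3 B)
    {S : Finset (ZMod v)} {x : ZMod v} (hx : x ∉ fixedBy B S) :
    2 * (fixedBy B S).ncard ≤ (fixedBy B (insert x S)).ncard := by
  have hne : ∀ t ∈ fixedBy B S, x ≠ t := fun t ht h => hx (h ▸ ht)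
  have hex : ∀ t : ZMod v, ∃ z, x ≠ t → z ≠ x ∧ z ≠ t ∧ tri x t z ∈ B := fun t => by
    by_cases h : x = t
    · exact ⟨0, fun h' => absurd h h'⟩
    · obtain ⟨z, hz⟩ := exists_third hB h
      exact ⟨z, fun _ => hz⟩
  choose g hg using hex
  have hinj : Set.InjOn g (fixedBy B S) := by
    intro t ht t' ht' h
    obtain ⟨h₁, h₂, h₃⟩ := hg t (hne t ht)
    obtain ⟨-, -, h₆⟩ := hg t' (hne t' ht')
    rw [← h, tri_rotate, tri_rotate, tri_swap] at h₆
    rw [tri_rotate, tri_rotate, tri_swap] at h₃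
    exact third_unique hB h₁.symm (hne t ht).symm h₂.symm h₃ h₆
  have hdisj : Disjoint (fixedBy B S) (g '' fixedBy B S) := by
    rw [Set.disjoint_right]
    rintro _ ⟨t, ht, rfl⟩ hgt
    obtain ⟨h₁, h₂, h₃⟩ := hg t (hne t ht)
    exact hx (fixedBy_closed hB h₂.symm (hne t ht) h₁.symm (tri_rotate x t _ ▸ h₃) ht hgt)
  have hsub : fixedBy B S ∪ g '' fixedBy B S ⊆ fixedBy B (insert x S) := by
    have hmono := fixedBy_mono B (Finset.subset_insert x S)
    apply Set.union_subset hmono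
    rintro _ ⟨t, ht, rfl⟩
    obtain ⟨h₁, h₂, h₃⟩ := hg t (hne t ht)
    exact fixedBy_closed hB (hne t ht) h₁ h₂ h₃
      (subset_fixedBy B _ (Finset.mem_insert_self x S)) (hmono ht)
  calc 2 * (fixedBy B S).ncard = (fixedBy B S ∪ g '' fixedBy B S).ncard := by
        rw [Set.ncard_union_eq hdisj, hinj.ncard_image, two_mul]
    _ ≤ _ := Set.ncard_le_ncard hsub

lemma exists_card_le_fixedBy [NeZero v] {B : Set (Block v)} (hB : IsDesign v 3 B) (k : ℕ) :
    ∃ S : Finset (ZMod v), S.card ≤ k + 1 ∧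
      (fixedBy B S = Set.univ ∨ 2 ^ k ≤ (fixedBy B S).ncard) := by
  induction k with
  | zero =>
    refine ⟨{0}, by simp, Or.inr ?_⟩
    rw [pow_zero, Nat.one_le_iff_ne_zero, ← Nat.pos_iff_ne_zero, Set.ncard_pos]
    exact ⟨0, subset_fixedBy B _ (by simp)⟩
  | succ k ih =>
    obtain ⟨S, hS, hS'⟩ := ih
    by_cases hu : fixedBy B S = Set.univ
    · exact ⟨S, by omega, Or.inl hu⟩
    · obtain ⟨x, hx⟩ := (Set.ne_univ_iff_exists_notMem _).1 hu
      have h₁ := two_mul_ncard_fixedBy_le hB hx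
      have h₂ := hS'.resolve_left hu
      exact ⟨insert x S, (Finset.card_insert_le _ _).trans (by omega), Or.inr (by omega)⟩

lemma exists_base [NeZero v] {B : Set (Block v)} (hB : IsDesign v 3 B) {k : ℕ} (hk : v < 2 ^ k) :
    ∃ S : Finset (ZMod v), S.card ≤ k + 1 ∧ fixedBy B S = Set.univ := by
  obtain ⟨S, hS, h | h⟩ := exists_card_le_fixedBy hB k
  · exact ⟨S, hS, h⟩
  · have := Set.ncard_le_card (fixedBy B S)
    rw [Nat.card_eq_fintype_card, ZMod.card] at this
    omega

lemma ncard_autSet_le [NeZero v] {B : Set (Block v)} (hB : IsDesign v 3 B) {k : ℕ}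
    (hk : v < 2 ^ k) : Nat.card (autSet B) ≤ v ^ (k + 1) := by
  obtain ⟨S, hS, hu⟩ := exists_base hB hk
  have hinj : Function.Injective fun (f : autSet B) (s : S) => f.1 s.1 := by
    intro f g hfg
    have hmem : f.1.trans g.1.symm ∈ autSet B := by
      have hg : mapBlocks g.1 B = B := g.2
      have hf : mapBlocks f.1 B = B := f.2
      change mapBlocks _ B = B
      have h := mapBlocks_mapBlocks g.1 g.1.symm B
      rw [Equiv.self_trans_symm, mapBlocks_refl, hg] at h
      rw [← mapBlocks_mapBlocks, hf, h]
    refine Subtype.ext (Equiv.ext fun x => ?_)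
    have hx : x ∈ fixedBy B S := hu ▸ Set.mem_univ x
    have := hx _ hmem fun s hs => by
      have := congrFun hfg ⟨s, hs⟩
      simpa [Equiv.symm_apply_eq] using this
    simpa [Equiv.symm_apply_eq] using this
  calc Nat.card (autSet B) ≤ Nat.card (S → ZMod v) := Nat.card_le_card_of_injective _ hinj
    _ = v ^ S.card := by simp
    _ ≤ v ^ (k + 1) := Nat.pow_le_pow_right (NeZero.pos v) hS

lemma equiv_eq_of_conj_eq [NeZero v] {f g : ZMod v ≃ ZMod v} (hf : f 0 = 0) (hg : g 0 = 0)
    (h : (f.trans (Equiv.addRight 1)).trans f.symm = (g.trans (Equiv.addRight 1)).trans g.symm) :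
    f = g := by
  have key (k : ℕ) : f.symm (k : ZMod v) = g.symm (k : ZMod v) := by
    induction k with
    | zero => rw [Nat.cast_zero, (f.symm_apply_eq).2 hf.symm, (g.symm_apply_eq).2 hg.symm]
    | succ k ih =>
      have := Equiv.congr_fun h (f.symm k)
      simp only [Equiv.trans_apply, Equiv.apply_symm_apply, Equiv.coe_addRight] at this
      rw [ih, Equiv.apply_symm_apply] at this
      exact_mod_cast this
  have : f.symm = g.symm := by
    ext x
    have := key x.val
    rw [ZMod.natCast_zmod_val] at this
    rw [this]
  simpa using congrArg Equiv.symm this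

lemma card_isomorphic_le [NeZero v] {B : Set (Block v)} (hB : IsCyclicDesign v 3 B) {k : ℕ}
    (hk : v < 2 ^ k) :
    Nat.card {B' : {B : Set (Block v) // IsCyclicDesign v 3 B} // Isomorphic B B'.1} ≤
      v ^ (k + 1) := by
  have hex : ∀ B' : {B' : {B : Set (Block v) // IsCyclicDesign v 3 B} // Isomorphic B B'.1},
      ∃ f : ZMod v ≃ ZMod v, f 0 = 0 ∧ mapBlocks f B = B'.1.1 := by
    rintro ⟨⟨B', hB'⟩, f, hf⟩
    refine ⟨f.trans (Equiv.addRight (-f 0)), by simp, ?_⟩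
    rw [← mapBlocks_mapBlocks]
    change mapBlocks _ ((fun E : Block v => E.image (Sym2.map f)) '' B) = B'
    rw [← hf, mapBlocks_addRight hB']
  choose F hF₀ hF using hex
  have hmem : ∀ B', ((F B').trans (Equiv.addRight 1)).trans (F B').symm ∈ autSet B := by
    intro B'
    change mapBlocks _ B = B
    rw [← mapBlocks_mapBlocks, ← mapBlocks_mapBlocks, hF, mapBlocks_addRight B'.1.2, ← hF,
      mapBlocks_mapBlocks, Equiv.self_trans_symm, mapBlocks_refl]
  refine (Nat.card_le_card_of_injective
    (fun B' => (⟨_, hmem B'⟩ : autSet B)) ?_).trans (ncard_autSet_le hB.1 hk)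
  intro B₁ B₂ h
  have := equiv_eq_of_conj_eq (hF₀ B₁) (hF₀ B₂) (Subtype.ext_iff.1 h)
  ext1; ext1
  rw [← hF, ← hF, this]

lemma isomorphic_equivalence :
    Equivalence fun B B' : {B : Set (Block v) // IsCyclicDesign v 3 B} =>
      Isomorphic B.1 B'.1 where
  refl B := ⟨Equiv.refl _, (mapBlocks_refl B.1).symm⟩
  symm := by
    rintro B B' ⟨f, hf⟩
    refine ⟨f.symm, ?_⟩
    rw [hf]
    change B.1 = mapBlocks f.symm (mapBlocks f B.1)
    rw [mapBlocks_mapBlocks, Equiv.self_trans_symm, mapBlocks_refl]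
  trans := by
    rintro B B' B'' ⟨f, hf⟩ ⟨g, hg⟩
    refine ⟨f.trans g, ?_⟩
    rw [hg, hf]
    exact mapBlocks_mapBlocks f g B.1

/-- Isomorphism classes of cyclic Steiner triple systems have quasi-polynomial size. -/
theorem card_cyclicDesign_le [NeZero v] {k : ℕ} (hk : v < 2 ^ k) :
    Nat.card {B : Set (Block v) // IsCyclicDesign v 3 B} ≤ NC v 3 * v ^ (k + 1) := by
  classical
  have := Fintype.ofFinite {B : Set (Block v) // IsCyclicDesign v 3 B}
  let r := fun B B' : {B : Set (Block v) // IsCyclicDesign v 3 B} => Isomorphic B.1 B'.1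
  have := Fintype.ofFinite (Quot r)
  have hfib : ∀ c ∈ (Finset.univ : Finset (Quot r)),
      (Finset.univ.filter fun B => Quot.mk r B = c).card ≤ v ^ (k + 1) := by
    intro c _
    obtain ⟨B, rfl⟩ := Quot.exists_rep c
    refine le_trans ?_ (card_isomorphic_le B.2 hk)
    rw [Nat.card_eq_fintype_card, Fintype.card_subtype]
    refine Finset.card_le_card fun B' hB' => ?_
    simp only [Finset.mem_filter, Finset.mem_univ, true_and] at hB' ⊢
    exact isomorphic_equivalence.symm
      ((isomorphic_equivalence.eqvGen_iff).1 (Quot.eqvGen_exact hB'))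
  have := Finset.card_le_mul_card_image_of_maps_to
    (f := Quot.mk r) (s := Finset.univ) (t := Finset.univ) (fun _ _ => Finset.mem_univ _) _ hfib
  rw [NC, Nat.card_eq_fintype_card, Nat.card_eq_fintype_card, mul_comm]
  simpa [Finset.card_univ] using this

end Automorphisms

section Rotations

variable {v : ℕ}

/-- The maps `ρ` that encode the cyclic Steiner triple systems on `ZMod v`: the third point of the
block through `x ≠ y` is `x + ρ (x - y)`. -/
def rotations (v : ℕ) : Set (ZMod v → ZMod v) :=
  {ρ | ρ 0 = 0 ∧ (∀ d, d + ρ d + ρ (ρ d) = 0) ∧ ∀ d, ρ (-ρ d) = -d}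

/-- The third point of the block through `x` and `y`. -/
def third (ρ : ZMod v → ZMod v) (x y : ZMod v) : ZMod v := x + ρ (x - y)

/-- The triple system with third-point operation `third ρ`. -/
def rotationDesign (ρ : ZMod v → ZMod v) : Set (Block v) :=
  {E | ∃ x y, x ≠ y ∧ E = tri x y (third ρ x y)}

variable {ρ : ZMod v → ZMod v}

lemma third_comm (hρ : ρ ∈ rotations v) (x y : ZMod v) : third ρ x y = third ρ y x := by
  obtain ⟨-, h₁, h₂⟩ := hρ
  have h₃ := h₁ (x - y)
  have h₄ := h₁ (ρ (x - y))
  have h₅ := h₂ (ρ (ρ (x - y)))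
  have h₆ : ρ (ρ (ρ (x - y))) = x - y := by linear_combination h₄ - h₃
  rw [h₆, neg_sub] at h₅
  unfold third
  linear_combination h₃ - h₅

lemma third_third (hρ : ρ ∈ rotations v) (x y : ZMod v) : third ρ x (third ρ x y) = y := by
  obtain ⟨-, -, h₂⟩ := hρ
  have h₃ := h₂ (x - y)
  have h₄ : x - (x + ρ (x - y)) = -ρ (x - y) := by ring
  rw [third, third, h₄, h₃]
  ring

lemma third_ne_left (hρ : ρ ∈ rotations v) {x y : ZMod v} (hxy : x ≠ y) : third ρ x y ≠ x := by
  intro h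
  have h₁ : ρ (x - y) = 0 := by simpa [third] using h
  have h₂ := hρ.2.2 (x - y)
  rw [h₁, neg_zero, hρ.1, zero_eq_neg, sub_eq_zero] at h₂
  exact hxy h₂

lemma third_ne_right (hρ : ρ ∈ rotations v) {x y : ZMod v} (hxy : x ≠ y) : third ρ x y ≠ y := by
  rw [third_comm hρ]
  exact third_ne_left hρ hxy.symm

lemma eq_tri_third (hρ : ρ ∈ rotations v) {x y a b : ZMod v} (hxy : x ≠ y) (hab : a ≠ b)
    (h : s(a, b) ∈ tri x y (third ρ x y)) :
    tri x y (third ρ x y) = tri a b (third ρ a b) := by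
  have h₁ := third_third hρ x y
  have h₂ : third ρ (third ρ x y) x = y := by rw [third_comm hρ, h₁]
  have h₃ : third ρ y (third ρ x y) = x := by rw [third_comm hρ x y, third_third hρ]
  have h₄ : third ρ (third ρ x y) y = x := by rw [third_comm hρ, h₃]
  simp only [mem_tri, Sym2.eq_iff] at h
  rcases h with (⟨rfl, rfl⟩ | ⟨rfl, rfl⟩) | (⟨rfl, rfl⟩ | ⟨rfl, rfl⟩) | (⟨rfl, rfl⟩ | ⟨rfl, rfl⟩)
  · rfl
  · rw [third_comm hρ b a, tri_swap]
  · rw [h₃, tri_rotate]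
  · rw [h₄, tri_rotate, tri_swap]
  · rw [h₂, tri_rotate, tri_rotate]
  · rw [h₁, tri_rotate, tri_rotate, tri_swap]

lemma rotationDesign_isCyclicDesign (hρ : ρ ∈ rotations v) :
    IsCyclicDesign v 3 (rotationDesign ρ) := by
  refine ⟨⟨?_, ?_⟩, ?_⟩
  · rintro _ ⟨x, y, hxy, rfl⟩
    exact isCycleBlock_three_iff.2
      ⟨x, y, _, hxy, (third_ne_right hρ hxy).symm, third_ne_left hρ hxy, rfl⟩
  · intro e he
    induction e with | _ a b
    have hab : a ≠ b := by simpa using he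
    refine ⟨tri a b (third ρ a b), ⟨⟨a, b, hab, rfl⟩, mem_tri.2 (Or.inl rfl)⟩, ?_⟩
    rintro _ ⟨⟨x, y, hxy, rfl⟩, h⟩
    exact eq_tri_third hρ hxy hab h
  · rintro _ ⟨x, y, hxy, rfl⟩ z
    refine ⟨x + z, y + z, by simpa using hxy, ?_⟩
    rw [translateBlock, image_tri]
    congr 1
    simp only [third, add_sub_add_right_eq_sub]
    ring

lemma rotationDesign_injOn : Set.InjOn rotationDesign (rotations v) := by
  intro ρ hρ ρ' hρ' h
  ext d
  by_cases hd : d = 0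
  · rw [hd, hρ.1, hρ'.1]
  have h0d : (0 : ZMod v) ≠ -d := by simpa [eq_comm] using hd
  have hmem : tri 0 (-d) (third ρ 0 (-d)) ∈ rotationDesign ρ' := h ▸ ⟨_, _, h0d, rfl⟩
  have := third_unique (rotationDesign_isCyclicDesign hρ').1 h0d (third_ne_left hρ h0d)
    (third_ne_right hρ h0d) hmem ⟨_, _, h0d, rfl⟩
  simpa [third] using this

lemma card_rotations_le [NeZero v] :
    Nat.card (rotations v) ≤ Nat.card {B : Set (Block v) // IsCyclicDesign v 3 B} :=
  Nat.card_le_card_of_injective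
    (fun ρ => ⟨rotationDesign ρ.1, rotationDesign_isCyclicDesign ρ.2⟩) fun ρ ρ' h =>
      Subtype.ext (rotationDesign_injOn ρ.2 ρ'.2 (Subtype.ext_iff.1 h))

/-- The groupings of a family `e` into zero-sum triples, each with a cyclic order, recorded by the
successor map. -/
def zeroSumSuccessors {J : Type*} (e : J → ZMod v) : Set (J → J) :=
  {s | ∀ j, e j + e (s j) + e (s (s j)) = 0}

/-- Sign change of the indices of the elements `± e j` and `0, h, -h`. -/
def negIndex {J : Type*} : (J × Bool) ⊕ Fin 3 → (J × Bool) ⊕ Fin 3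
  | Sum.inl (j, b) => Sum.inl (j, !b)
  | Sum.inr i => Sum.inr (-i)

/-- The action of a successor map on the indices of the elements `± e j` and `0, h, -h`. -/
def rotIndex {J : Type*} (s : J → J) : (J × Bool) ⊕ Fin 3 → (J × Bool) ⊕ Fin 3
  | Sum.inl (j, false) => Sum.inl (s j, false)
  | Sum.inl (j, true) => Sum.inl (s (s j), true)
  | Sum.inr i => Sum.inr i

/-- The elements `± e j` and `0, h, -h` of `ZMod v`. -/
def indexValue {J : Type*} (e : J → ZMod v) (h : ZMod v) : (J × Bool) ⊕ Fin 3 → ZMod v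
  | Sum.inl (j, false) => e j
  | Sum.inl (j, true) => -e j
  | Sum.inr 0 => 0
  | Sum.inr 1 => h
  | Sum.inr 2 => -h

lemma indexValue_bijective [NeZero v] {J : Type*} [Fintype J] {e : J → ZMod v} {h : ZMod v}
    (hJ : 2 * Fintype.card J + 3 = v)
    (hcover : ∀ w, w = 0 ∨ w = h ∨ w = -h ∨ ∃ j, w = e j ∨ w = -e j) :
    Function.Bijective (indexValue e h) := by
  rw [Fintype.bijective_iff_surjective_and_card]
  constructor
  · intro w
    rcases hcover w with rfl | rfl | rfl | ⟨j, rfl | rfl⟩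
    exacts [⟨Sum.inr 0, rfl⟩, ⟨Sum.inr 1, rfl⟩, ⟨Sum.inr 2, rfl⟩, ⟨Sum.inl (j, false), rfl⟩,
      ⟨Sum.inl (j, true), rfl⟩]
  · simp only [Fintype.card_sum, Fintype.card_prod, Fintype.card_bool, Fintype.card_fin, ZMod.card]
    omega

lemma card_zeroSumSuccessors_le [NeZero v] {J : Type*} [Fintype J] {e : J → ZMod v} {h : ZMod v}
    (hJ : 2 * Fintype.card J + 3 = v) (hh : 3 * h = 0)
    (hcover : ∀ w, w = 0 ∨ w = h ∨ w = -h ∨ ∃ j, w = e j ∨ w = -e j) :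
    Nat.card (zeroSumSuccessors e) ≤ Nat.card (rotations v) := by
  have hbij := indexValue_bijective hJ hcover
  let E := Equiv.ofBijective _ hbij
  have hE (x) : E x = indexValue e h x := rfl
  have he : Function.Injective e := fun i j hij => by
    have : E (Sum.inl (i, false)) = E (Sum.inl (j, false)) := hij
    simpa using E.injective this
  have hneg (x) : -E x = E (negIndex x) := by
    rcases x with ⟨j, _ | _⟩ | i
    · rfl
    · exact neg_neg _
    · fin_cases i
      exacts [neg_zero, rfl, neg_neg _]
  have hcube {s : J → J} (hs : s ∈ zeroSumSuccessors e) (j : J) : s (s (s j)) = j := by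
    apply he
    linear_combination hs (s j) - hs j
  have hrot {s : J → J} (hs : s ∈ zeroSumSuccessors e) :
      (fun w => E (rotIndex s (E.symm w))) ∈ rotations v := by
    refine ⟨?_, fun w => ?_, fun w => ?_⟩
    · have h0 : (0 : ZMod v) = E (Sum.inr 0) := rfl
      simp only [h0, Equiv.symm_apply_apply, rotIndex]
    · obtain ⟨x, rfl⟩ := E.surjective w
      simp only [Equiv.symm_apply_apply]
      rcases x with ⟨j, _ | _⟩ | i
      · exact hs j
      · have := hs j
        simp only [rotIndex, hE, indexValue, hcube hs]
        linear_combination -this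
      · fin_cases i <;> simp only [rotIndex, hE, indexValue]
        · simp
        · linear_combination hh
        · linear_combination -hh
    · obtain ⟨x, rfl⟩ := E.surjective w
      simp only [Equiv.symm_apply_apply, hneg]
      congr 1
      rcases x with ⟨j, _ | _⟩ | i <;> simp [rotIndex, negIndex, hcube hs]
  refine Nat.card_le_card_of_injective (fun s => ⟨_, hrot s.2⟩) fun s s' hss => ?_
  refine Subtype.ext (funext fun j => ?_)
  have := congrFun (Subtype.ext_iff.1 hss) (E (Sum.inl (j, false)))
  simp only [Equiv.symm_apply_apply, rotIndex] at this
  exact he this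

end Rotations

section Blocks

/-- The nine elements of a block of three consecutive triples are `base k + blockOffset (k, e)`
with `base 0 + base 1 + base 2 = 0`. -/
def blockOffset (a : Fin 3 × Fin 3) : ℤ := if a.1 = 2 then -(a.2.1 + 1) else a.2.1

/-- The sixteen ways to group the nine elements of a block into cyclically ordered zero-sum
triples: a choice of two groupings, and an orientation for each of the three triples. -/
def blockSuccessor (o : Bool × (Fin 3 → Bool)) : Fin 3 × Fin 3 → Fin 3 × Fin 3 :=
  let f : Fin 3 → Fin 3 := fun e => bif o.1 then e + 2 else e + 1
  let f' : Fin 3 → Fin 3 := fun e => bif o.1 then e + 1 else e + 2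
  let g : Fin 3 → Fin 3 := fun e => bif o.1 then 2 * e + 1 else 2 * e
  fun a =>
    if a.1 = 0 then bif o.2 a.2 then (2, g a.2) else (1, f a.2)
    else if a.1 = 1 then bif o.2 (f' a.2) then (0, f' a.2) else (2, g (f' a.2))
    else bif o.2 (g a.2) then (1, f (g a.2)) else (0, g a.2)

lemma blockSuccessor_spec (o : Bool × (Fin 3 → Bool)) (a : Fin 3 × Fin 3) :
    blockOffset a + blockOffset (blockSuccessor o a) +
        blockOffset (blockSuccessor o (blockSuccessor o a)) = 0 ∧
      ((blockSuccessor o a).1 = a.1 + 1 ∧ (blockSuccessor o (blockSuccessor o a)).1 = a.1 + 2 ∨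
        (blockSuccessor o a).1 = a.1 + 2 ∧ (blockSuccessor o (blockSuccessor o a)).1 = a.1 + 1) := by
  revert o a
  decide +kernel

lemma blockSuccessor_injective : Function.Injective blockSuccessor := by
  have : ∀ o o', (∀ a, blockSuccessor o a = blockSuccessor o' a) → o = o' := by decide +kernel
  exact fun o o' h => this o o' (congrFun h)

/-- Group each block independently, and keep the exceptional triples. -/
def glueSuccessors {β ι : Type*} (c : β → Bool × (Fin 3 → Bool)) :
    (β × (Fin 3 × Fin 3)) ⊕ (ι × Fin 3) → (β × (Fin 3 × Fin 3)) ⊕ (ι × Fin 3)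
  | Sum.inl (b, a) => Sum.inl (b, blockSuccessor (c b) a)
  | Sum.inr (i, k) => Sum.inr (i, k + 1)

lemma glueSuccessors_injective {β ι : Type*} :
    Function.Injective (glueSuccessors (β := β) (ι := ι)) := by
  intro c c' h
  refine funext fun b => blockSuccessor_injective (funext fun a => ?_)
  simpa [glueSuccessors] using congrFun h (Sum.inl (b, a) : _ ⊕ (ι × Fin 3))

/-- The elements covered by blocks with given bases and by exceptional triples. -/
def glueValue {β ι : Type*} (base : β → Fin 3 → ℤ) (exc : ι → Fin 3 → ℤ) :
    (β × (Fin 3 × Fin 3)) ⊕ (ι × Fin 3) → ℤ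
  | Sum.inl (b, a) => base b a.1 + blockOffset a
  | Sum.inr (i, k) => exc i k

lemma card_le_card_zeroSumSuccessors {β ι : Type*} [Fintype β] [Fintype ι] {v : ℕ}
    {base : β → Fin 3 → ℤ} {exc : ι → Fin 3 → ℤ}
    (hbase : ∀ b, base b 0 + base b 1 + base b 2 = 0)
    (hexc : ∀ i, (v : ℤ) ∣ exc i 0 + exc i 1 + exc i 2) :
    16 ^ Fintype.card β ≤
      Nat.card (zeroSumSuccessors fun j => (glueValue base exc j : ZMod v)) := by
  have hmem (c : β → Bool × (Fin 3 → Bool)) :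
      glueSuccessors c ∈ zeroSumSuccessors fun j => (glueValue base exc j : ZMod v) := by
    rintro (⟨b, a⟩ | ⟨i, k⟩)
    · have hsum : base b a.1 + base b (a.1 + 1) + base b (a.1 + 2) = 0 := by
        have := hbase b
        generalize a.1 = k
        fin_cases k <;> simp <;> linarith
      obtain ⟨h, ⟨h₁, h₂⟩ | ⟨h₁, h₂⟩⟩ := blockSuccessor_spec (c b) a <;>
      · simp only [glueSuccessors, glueValue, h₁, h₂]
        norm_cast
        rw [← Int.cast_zero]
        congr 1
        linarith
    · simp only [glueSuccessors, glueValue]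
      norm_cast
      rw [ZMod.intCast_zmod_eq_zero_iff_dvd]
      have := hexc i
      fin_cases k
      · exact this
      · convert this using 1; simp; ring
      · convert this using 1; simp; ring
  calc 16 ^ Fintype.card β = Nat.card (β → Bool × (Fin 3 → Bool)) := by
        rw [Nat.card_fun, Nat.card_prod, Nat.card_fun]
        simp
    _ ≤ _ := Nat.card_le_card_of_injective (fun c => ⟨_, hmem c⟩)
      fun c c' h => glueSuccessors_injective (Subtype.ext_iff.1 h)

end Blocks

section Starters

/-- Data for triple systems on `6 * (12 * q + r) + 3` points, for all `q` at once. The pair `(κ, c)`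
stands for the difference `3 * κ * q + c`; the parameters `p, …, y₃` locate four families of `q`
blocks, and `exc` lists the `r` triples of differences outside these families. -/
structure Starter where
  (r : ℕ)
  (p p' y₀ y₁ y₂ y₃ : ℤ)
  (exc : Fin r → Fin 3 → ℤ × ℤ)

namespace Starter

/-- The intervals `[3 * κ * q + a, 3 * κ * q + b)`, listed as `(κ, a, b)`, that the four families
leave uncovered. -/
def gaps (S : Starter) : List (ℤ × ℤ × ℤ) :=
  [(0, 1, S.p), (2, S.p, S.p'), (4, S.p', S.y₂ + 3), (5, S.y₂ + 3, S.y₀ + 3),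
    (6, S.y₀ + 3, S.p + S.y₀ + 1), (7, S.p + S.y₀ + 1, S.p' + S.y₂ + 1),
    (8, S.p' + S.y₂ + 1, S.y₃ + 3), (9, S.y₃ + 3, S.y₁ + 3), (10, S.y₁ + 3, S.p + S.y₁ + 4),
    (11, S.p + S.y₁ + 4, S.p' + S.y₃ + 4), (12, S.p' + S.y₃ + 4, 3 * S.r + 2)]

/-- The exceptional triples are zero-sum and cover the gaps up to sign, apart from a third of the
order. -/
def Valid (S : Starter) : Prop :=
  (∀ i, S.exc i 0 + S.exc i 1 + S.exc i 2 = 0 ∨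
    S.exc i 0 + S.exc i 1 + S.exc i 2 = ((24 : ℤ), 6 * (S.r : ℤ) + 3)) ∧
  ∀ g ∈ S.gaps, ∀ t ∈ List.range (g.2.2 - g.2.1).toNat,
    (g.1, g.2.1 + (t : ℤ)) = ((8 : ℤ), 2 * (S.r : ℤ) + 1) ∨
      ∃ i k, S.exc i k = (g.1, g.2.1 + (t : ℤ)) ∨ S.exc i k = -(g.1, g.2.1 + (t : ℤ))

instance (S : Starter) : Decidable S.Valid := by
  unfold Valid
  infer_instance

/-- The least difference of each of the four families. -/
def lowX (S : Starter) (q : ℕ) : Fin 4 → ℤ :=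
  ![S.p, S.p + 3, 6 * q + S.p', 6 * q + S.p' + 3]

/-- The position of the first middle interval of each of the four families. -/
def lowY (S : Starter) (q : ℕ) : Fin 4 → ℤ :=
  ![18 * q + S.y₀, 30 * q + S.y₁, 15 * q + S.y₂, 27 * q + S.y₃]

/-- The bases of the blocks of the four families. -/
def base (S : Starter) (q : ℕ) (b : Fin 4 × Fin q) : Fin 3 → ℤ :=
  ![S.lowX q b.1 + 6 * (b.2 : ℕ), S.lowY q b.1 - 3 * (b.2 : ℕ),
    -(S.lowX q b.1 + S.lowY q b.1 + 3 * (b.2 : ℕ))]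

/-- The exceptional triples for a given `q`. -/
def excValue (S : Starter) (q : ℕ) (i : Fin S.r) (k : Fin 3) : ℤ :=
  3 * (S.exc i k).1 * q + (S.exc i k).2

/-- `m` or `-m` belongs to one of the families or exceptional triples. -/
def Covers (S : Starter) (q : ℕ) (m : ℤ) : Prop :=
  ∃ j, m = glueValue (S.base q) (S.excValue q) j ∨ m = -glueValue (S.base q) (S.excValue q) j

lemma covers_first {S : Starter} {q : ℕ} {m : ℤ} (f : Fin 4) (h₀ : S.lowX q f ≤ m)
    (h₁ : m < S.lowX q f + 6 * q) (h₂ : (m - S.lowX q f) % 6 < 3) : S.Covers q m := by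
  refine ⟨Sum.inl ((f, ⟨((m - S.lowX q f) / 6).toNat, by omega⟩),
    (0, ⟨((m - S.lowX q f) % 6).toNat, by omega⟩)), Or.inl ?_⟩
  simp [glueValue, base, blockOffset]
  omega

lemma covers_second {S : Starter} {q : ℕ} {m : ℤ} (f : Fin 4) (h₀ : S.lowY q f + 3 - 3 * q ≤ m)
    (h₁ : m < S.lowY q f + 3) : S.Covers q m := by
  refine ⟨Sum.inl ((f, ⟨((S.lowY q f + 2 - m) / 3).toNat, by omega⟩),
    (1, ⟨(2 - (S.lowY q f + 2 - m) % 3).toNat, by omega⟩)), Or.inl ?_⟩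
  simp [glueValue, base, blockOffset]
  omega

lemma covers_third {S : Starter} {q : ℕ} {m : ℤ} (f : Fin 4)
    (h₀ : S.lowX q f + S.lowY q f + 1 ≤ m)
    (h₁ : m < S.lowX q f + S.lowY q f + 1 + 3 * q) : S.Covers q m := by
  refine ⟨Sum.inl ((f, ⟨((m - (S.lowX q f + S.lowY q f + 1)) / 3).toNat, by omega⟩),
    (2, ⟨((m - (S.lowX q f + S.lowY q f + 1)) % 3).toNat, by omega⟩)), Or.inr ?_⟩
  simp [glueValue, base, blockOffset]
  omega

lemma Valid.covers_gap {S : Starter} (hS : S.Valid) {q : ℕ} {m : ℤ} {g : ℤ × ℤ × ℤ}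
    (hg : g ∈ S.gaps) (h₀ : 3 * g.1 * q + g.2.1 ≤ m) (h₁ : m < 3 * g.1 * q + g.2.2) :
    m = 24 * q + 2 * S.r + 1 ∨ S.Covers q m := by
  have ht : (((m - (3 * g.1 * q + g.2.1)).toNat : ℕ) : ℤ) = m - (3 * g.1 * q + g.2.1) :=
    Int.toNat_of_nonneg (by linarith)
  rcases hS.2 g hg (m - (3 * g.1 * q + g.2.1)).toNat
    (by rw [List.mem_range, ← Int.ofNat_lt, ht]; omega) with h | ⟨i, k, h | h⟩ <;>
    rw [ht] at h
  · left
    obtain ⟨h₂, h₃⟩ := Prod.ext_iff.1 h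
    dsimp only at h₂ h₃
    rw [h₂] at h₃
    linarith
  · refine Or.inr ⟨Sum.inr (i, k), Or.inl ?_⟩
    simp only [glueValue, excValue, h]
    ring
  · refine Or.inr ⟨Sum.inr (i, k), Or.inr ?_⟩
    simp only [glueValue, excValue, h, Prod.fst_neg, Prod.snd_neg]
    ring

lemma Valid.covers {S : Starter} (hS : S.Valid) {q : ℕ} {m : ℤ} (h₀ : 1 ≤ m)
    (h₁ : m ≤ 36 * q + 3 * S.r + 1) : m = 24 * q + 2 * S.r + 1 ∨ S.Covers q m := by
  have hgap (g) (hg : g ∈ S.gaps) := hS.covers_gap (q := q) (m := m) hg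
  simp only [gaps, List.forall_mem_cons, List.not_mem_nil, false_imp_iff, implies_true,
    and_true] at hgap
  obtain ⟨g₀, g₂, g₄, g₅, g₆, g₇, g₈, g₉, g₁₀, g₁₁, g₁₂⟩ := hgap
  have hX (f : Fin 4) := covers_first (S := S) (q := q) (m := m) f
  have hY (f : Fin 4) := covers_second (S := S) (q := q) (m := m) f
  have hZ (f : Fin 4) := covers_third (S := S) (q := q) (m := m) f
  have hX₀ := hX 0
  have hX₁ := hX 1
  have hX₂ := hX 2
  have hX₃ := hX 3
  have hY₀ := hY 0
  have hY₁ := hY 1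
  have hY₂ := hY 2
  have hY₃ := hY 3
  have hZ₀ := hZ 0
  have hZ₁ := hZ 1
  have hZ₂ := hZ 2
  have hZ₃ := hZ 3
  clear hX hY hZ
  simp only [lowX, lowY, Matrix.cons_val] at hX₀ hX₁ hX₂ hX₃ hY₀ hY₁ hY₂ hY₃ hZ₀ hZ₁ hZ₂ hZ₃
  rcases lt_or_ge m (S.p) with h | h
  · exact g₀ (by linarith) (by linarith)
  rcases lt_or_ge m (6 * q + S.p) with h | h
  · rcases lt_or_ge ((m - S.p) % 6) 3 with h' | h'
    · exact Or.inr (hX₀ (by omega) (by omega) h')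
    · exact Or.inr (hX₁ (by omega) (by omega) (by omega))
  rcases lt_or_ge m (6 * q + S.p') with h | h
  · exact g₂ (by linarith) (by linarith)
  rcases lt_or_ge m (12 * q + S.p') with h | h
  · rcases lt_or_ge ((m - (6 * q + S.p')) % 6) 3 with h' | h'
    · exact Or.inr (hX₂ (by omega) (by omega) h')
    · exact Or.inr (hX₃ (by omega) (by omega) (by omega))
  rcases lt_or_ge m (12 * q + S.y₂ + 3) with h | h
  · exact g₄ (by linarith) (by linarith)
  rcases lt_or_ge m (15 * q + S.y₂ + 3) with h | h
  · exact Or.inr (hY₂ (by linarith) (by linarith))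
  rcases lt_or_ge m (15 * q + S.y₀ + 3) with h | h
  · exact g₅ (by linarith) (by linarith)
  rcases lt_or_ge m (18 * q + S.y₀ + 3) with h | h
  · exact Or.inr (hY₀ (by linarith) (by linarith))
  rcases lt_or_ge m (18 * q + S.p + S.y₀ + 1) with h | h
  · exact g₆ (by linarith) (by linarith)
  rcases lt_or_ge m (21 * q + S.p + S.y₀ + 1) with h | h
  · exact Or.inr (hZ₀ (by linarith) (by linarith))
  rcases lt_or_ge m (21 * q + S.p' + S.y₂ + 1) with h | h
  · exact g₇ (by linarith) (by linarith)
  rcases lt_or_ge m (24 * q + S.p' + S.y₂ + 1) with h | h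
  · exact Or.inr (hZ₂ (by linarith) (by linarith))
  rcases lt_or_ge m (24 * q + S.y₃ + 3) with h | h
  · exact g₈ (by linarith) (by linarith)
  rcases lt_or_ge m (27 * q + S.y₃ + 3) with h | h
  · exact Or.inr (hY₃ (by linarith) (by linarith))
  rcases lt_or_ge m (27 * q + S.y₁ + 3) with h | h
  · exact g₉ (by linarith) (by linarith)
  rcases lt_or_ge m (30 * q + S.y₁ + 3) with h | h
  · exact Or.inr (hY₁ (by linarith) (by linarith))
  rcases lt_or_ge m (30 * q + S.p + S.y₁ + 4) with h | h
  · exact g₁₀ (by linarith) (by linarith)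
  rcases lt_or_ge m (33 * q + S.p + S.y₁ + 4) with h | h
  · exact Or.inr (hZ₁ (by linarith) (by linarith))
  rcases lt_or_ge m (33 * q + S.p' + S.y₃ + 4) with h | h
  · exact g₁₁ (by linarith) (by linarith)
  rcases lt_or_ge m (36 * q + S.p' + S.y₃ + 4) with h | h
  · exact Or.inr (hZ₃ (by linarith) (by linarith))
  exact g₁₂ (by linarith) (by linarith)

lemma Valid.card_le {S : Starter} (hS : S.Valid) (q : ℕ) :
    65536 ^ q ≤ Nat.card (rotations (6 * (12 * q + S.r) + 3)) := by
  set v := 6 * (12 * q + S.r) + 3 with hv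
  have : NeZero v := ⟨by omega⟩
  have hcard : 65536 ^ q = 16 ^ Fintype.card (Fin 4 × Fin q) := by
    rw [Fintype.card_prod, Fintype.card_fin, Fintype.card_fin, pow_mul]
    norm_num
  rw [hcard]
  refine (card_le_card_zeroSumSuccessors (v := v) (base := S.base q) (exc := S.excValue q)
    (fun b => ?_) fun i => ?_).trans
    (card_zeroSumSuccessors_le (h := ((2 * (12 * q + S.r) + 1 : ℕ) : ZMod v)) ?_ ?_ fun w => ?_)
  · simp only [base, Matrix.cons_val]
    ring
  · have hsum : S.excValue q i 0 + S.excValue q i 1 + S.excValue q i 2 =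
        3 * (S.exc i 0 + S.exc i 1 + S.exc i 2).1 * q +
          (S.exc i 0 + S.exc i 1 + S.exc i 2).2 := by
      simp only [excValue, Prod.fst_add, Prod.snd_add]
      ring
    rw [hsum]
    rcases hS.1 i with h | h <;> rw [h]
    · simp
    · refine ⟨1, ?_⟩
      rw [hv]
      push_cast
      ring
  · simp only [Fintype.card_sum, Fintype.card_prod, Fintype.card_fin]
    omega
  · have : ((v : ℕ) : ZMod v) = 0 := ZMod.natCast_self v
    rw [← this, hv]
    push_cast
    ring
  · have hpos (m : ℤ) (h₀ : 1 ≤ m) (h₁ : m ≤ 36 * q + 3 * S.r + 1) :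
        (m : ZMod v) = ((2 * (12 * q + S.r) + 1 : ℕ) : ZMod v) ∨
          ∃ j, (m : ZMod v) = (glueValue (S.base q) (S.excValue q) j : ZMod v) ∨
            (m : ZMod v) = -(glueValue (S.base q) (S.excValue q) j : ZMod v) := by
      rcases hS.covers h₀ h₁ with h | ⟨j, h | h⟩
      · left
        rw [h]
        push_cast
        ring
      · exact Or.inr ⟨j, Or.inl (congrArg _ h)⟩
      · exact Or.inr ⟨j, Or.inr (by rw [← Int.cast_neg, ← h])⟩
    have hw : ((w.valMinAbs : ℤ) : ZMod v) = w := ZMod.coe_valMinAbs w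
    have hmem := ZMod.valMinAbs_mem_Ioc w
    have hle : |w.valMinAbs| ≤ 36 * q + 3 * S.r + 1 := by
      rw [Set.mem_Ioc] at hmem
      rw [abs_le]
      omega
    rw [← hw]
    rcases lt_trichotomy w.valMinAbs 0 with h | h | h
    · rw [abs_of_neg h] at hle
      have := hpos (-w.valMinAbs) (by omega) hle
      rw [Int.cast_neg] at this
      rcases this with h' | ⟨j, h' | h'⟩
      · exact Or.inr (Or.inr (Or.inl (neg_eq_iff_eq_neg.1 h')))
      · exact Or.inr (Or.inr (Or.inr ⟨j, Or.inr (neg_eq_iff_eq_neg.1 h')⟩))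
      · exact Or.inr (Or.inr (Or.inr ⟨j, Or.inl (neg_injective h')⟩))
    · simp [h]
    · rw [abs_of_pos h] at hle
      have := hpos w.valMinAbs h hle
      rcases this with h' | ⟨j, h'⟩
      · exact Or.inr (Or.inl h')
      · exact Or.inr (Or.inr (Or.inr ⟨j, h'⟩))

end Starter

/-- A starter with 5 exceptional triples. -/
def starter5 : Starter :=
  ⟨5, 2, 4, 6, 10, 5, 9,
  ![![(4, 7), (7, 9), (-11, -16)], ![(5, 8), (9, 12), (10, 13)], ![(4, 4), (4, 6), (-8, -10)],
    ![(0, 1), (10, 14), (-10, -15)], ![(2, 2), (2, 3), (-4, -5)]]⟩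

/-- A starter with 6 exceptional triples. -/
def starter6 : Starter :=
  ⟨6, 4, 5, 6, 11, 6, 11,
  ![![(4, 8), (7, 11), (-11, -19)], ![(2, 4), (8, 12), (-10, -16)], ![(0, 2), (4, 5), (-4, -7)],
    ![(0, 1), (6, 9), (-6, -10)], ![(0, 3), (10, 14), (-10, -17)], ![(4, 6), (10, 15), (10, 18)]]⟩

/-- A starter with 7 exceptional triples. -/
def starter7 : Starter :=
  ⟨7, 2, 5, 9, 15, 6, 14,
  ![![(5, 11), (8, 12), (11, 22)], ![(2, 2), (2, 3), (-4, -5)], ![(2, 4), (8, 16), (-10, -20)],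
    ![(4, 6), (4, 7), (-8, -13)], ![(5, 10), (8, 14), (11, 21)], ![(0, 1), (10, 18), (-10, -19)],
    ![(4, 8), (5, 9), (-9, -17)]]⟩

/-- A starter with 8 exceptional triples. -/
def starter8 : Starter :=
  ⟨8, 4, 7, 11, 17, 8, 15,
  ![![(0, 2), (5, 11), (-5, -13)], ![(4, 7), (5, 12), (-9, -19)], ![(4, 8), (9, 18), (11, 25)],
    ![(0, 3), (10, 21), (-10, -24)], ![(0, 1), (10, 22), (-10, -23)],
    ![(2, 5), (4, 9), (-6, -14)], ![(6, 15), (8, 16), (10, 20)], ![(2, 4), (2, 6), (-4, -10)]]⟩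

/-- A starter with 9 exceptional triples. -/
def starter9 : Starter :=
  ⟨9, 4, 7, 10, 18, 7, 17,
  ![![(2, 4), (11, 26), (11, 27)], ![(5, 12), (9, 20), (10, 25)], ![(0, 1), (5, 10), (-5, -11)],
    ![(0, 3), (10, 21), (-10, -24)], ![(0, 2), (8, 15), (-8, -17)], ![(2, 5), (6, 13), (-8, -18)],
    ![(4, 7), (4, 9), (-8, -16)], ![(2, 6), (10, 23), (12, 28)], ![(4, 8), (6, 14), (-10, -22)]]⟩

/-- A starter with 10 exceptional triples. -/
def starter10 : Starter :=
  ⟨10, 4, 9, 14, 22, 10, 19,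
  ![![(0, 3), (5, 13), (-5, -16)], ![(5, 14), (5, 15), (-10, -29)], ![(7, 19), (8, 20), (9, 24)],
    ![(4, 10), (9, 22), (11, 31)], ![(2, 7), (9, 23), (-11, -30)], ![(4, 9), (6, 18), (-10, -27)],
    ![(0, 2), (2, 6), (-2, -8)], ![(0, 1), (2, 4), (-2, -5)], ![(4, 12), (10, 25), (10, 26)],
    ![(4, 11), (6, 17), (-10, -28)]]⟩

/-- A starter with 11 exceptional triples. -/
def starter11 : Starter :=
  ⟨11, 5, 10, 13, 22, 11, 21,
  ![![(0, 4), (2, 5), (-2, -9)], ![(0, 1), (10, 25), (-10, -26)], ![(0, 3), (4, 10), (-4, -13)],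
    ![(0, 2), (2, 6), (-2, -8)], ![(4, 12), (10, 27), (10, 30)], ![(4, 11), (9, 24), (11, 34)],
    ![(7, 20), (7, 21), (10, 28)], ![(2, 7), (8, 22), (-10, -29)],
    ![(5, 15), (6, 16), (-11, -31)], ![(6, 17), (7, 19), (11, 33)],
    ![(5, 14), (6, 18), (-11, -32)]]⟩

/-- A starter with 12 exceptional triples. -/
def starter12 : Starter :=
  ⟨12, 5, 11, 16, 27, 12, 23,
  ![![(0, 1), (0, 3), (0, -4)], ![(5, 17), (5, 18), (-10, -35)], ![(0, 2), (2, 8), (-2, -10)],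
    ![(5, 15), (9, 26), (10, 34)], ![(2, 9), (9, 28), (-11, -37)], ![(2, 7), (5, 16), (-7, -23)],
    ![(4, 14), (7, 22), (-11, -36)], ![(6, 19), (9, 27), (9, 29)], ![(2, 5), (2, 6), (-4, -11)],
    ![(4, 12), (6, 21), (-10, -33)], ![(6, 20), (8, 24), (10, 31)],
    ![(4, 13), (10, 30), (10, 32)]]⟩

/-- A starter with 13 exceptional triples. -/
def starter13 : Starter :=
  ⟨13, 5, 12, 16, 29, 13, 25,
  ![![(0, 1), (0, 3), (0, -4)], ![(4, 12), (10, 32), (10, 37)], ![(2, 11), (9, 29), (-11, -40)],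
    ![(0, 2), (2, 8), (-2, -10)], ![(7, 22), (7, 23), (10, 36)], ![(5, 18), (9, 28), (10, 35)],
    ![(2, 9), (9, 30), (-11, -39)], ![(2, 6), (7, 25), (-9, -31)],
    ![(5, 16), (5, 17), (-10, -33)], ![(2, 5), (4, 15), (-6, -20)],
    ![(4, 13), (6, 21), (-10, -34)], ![(4, 14), (7, 24), (-11, -38)],
    ![(2, 7), (6, 19), (-8, -26)]]⟩

/-- A starter with 14 exceptional triples. -/
def starter14 : Starter :=
  ⟨14, 9, 13, 15, 30, 13, 27,
  ![![(7, 25), (7, 26), (10, 36)], ![(0, 2), (0, 6), (0, -8)], ![(0, 7), (10, 34), (-10, -41)],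
    ![(0, 5), (10, 37), (-10, -42)], ![(0, 4), (6, 19), (-6, -23)], ![(0, 3), (6, 18), (-6, -21)],
    ![(2, 9), (4, 13), (-6, -22)], ![(6, 20), (8, 27), (10, 40)], ![(4, 15), (10, 33), (10, 39)],
    ![(6, 24), (8, 28), (10, 35)], ![(0, 1), (2, 10), (-2, -11)], ![(4, 14), (5, 16), (-9, -30)],
    ![(5, 17), (9, 32), (10, 38)], ![(2, 12), (9, 31), (-11, -43)]]⟩

/-- A starter with 15 exceptional triples. -/
def starter15 : Starter :=
  ⟨15, 6, 13, 19, 34, 14, 29,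
  ![![(0, 5), (2, 6), (-2, -11)], ![(0, 4), (10, 37), (-10, -41)],
    ![(0, 3), (10, 40), (-10, -43)], ![(2, 12), (9, 33), (-11, -45)],
    ![(4, 13), (10, 38), (10, 42)], ![(0, 1), (8, 28), (-8, -29)], ![(4, 14), (5, 18), (-9, -32)],
    ![(0, 2), (5, 17), (-5, -19)], ![(5, 21), (6, 23), (-11, -44)],
    ![(2, 10), (7, 26), (-9, -36)], ![(6, 22), (6, 25), (12, 46)], ![(2, 9), (8, 30), (-10, -39)],
    ![(2, 8), (4, 16), (-6, -24)], ![(4, 15), (5, 20), (-9, -35)], ![(2, 7), (7, 27), (-9, -34)]]⟩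

/-- A starter with 16 exceptional triples. -/
def starter16 : Starter :=
  ⟨16, 9, 14, 18, 35, 15, 32,
  ![![(0, 1), (0, 7), (0, -8)], ![(0, 2), (0, 4), (0, -6)], ![(6, 22), (8, 30), (10, 47)],
    ![(0, 5), (6, 21), (-6, -26)], ![(2, 10), (5, 19), (-7, -29)], ![(2, 9), (7, 28), (-9, -37)],
    ![(2, 13), (9, 36), (-11, -49)], ![(5, 20), (8, 31), (11, 48)], ![(5, 18), (9, 35), (10, 46)],
    ![(2, 12), (4, 15), (-6, -27)], ![(2, 11), (6, 23), (-8, -34)], ![(6, 24), (8, 32), (10, 43)],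
    ![(4, 17), (10, 40), (10, 42)], ![(4, 16), (10, 38), (10, 45)],
    ![(4, 14), (6, 25), (-10, -39)], ![(0, 3), (10, 41), (-10, -44)]]⟩

lemma exists_starter (n : ℕ) (hn : 16 ≤ n) :
    ∃ (S : Starter) (q : ℕ), S.Valid ∧ S.r ≤ 16 ∧ n = 12 * q + S.r := by
  have key (S : Starter) (hS : S.Valid ∧ S.r ≤ 16) (h : n % 12 = S.r % 12) :
      ∃ (S : Starter) (q : ℕ), S.Valid ∧ S.r ≤ 16 ∧ n = 12 * q + S.r :=
    ⟨S, (n - S.r) / 12, hS.1, hS.2, by have := hS.2; omega⟩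
  have h : n % 12 < 12 := Nat.mod_lt _ (by norm_num)
  interval_cases hr : n % 12
  · exact key starter12 (by decide +kernel) rfl
  · exact key starter13 (by decide +kernel) rfl
  · exact key starter14 (by decide +kernel) rfl
  · exact key starter15 (by decide +kernel) rfl
  · exact key starter16 (by decide +kernel) rfl
  · exact key starter5 (by decide +kernel) rfl
  · exact key starter6 (by decide +kernel) rfl
  · exact key starter7 (by decide +kernel) rfl
  · exact key starter8 (by decide +kernel) rfl
  · exact key starter9 (by decide +kernel) rfl
  · exact key starter10 (by decide +kernel) rfl
  · exact key starter11 (by decide +kernel) rfl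

end Starters

section Asymptotics

lemma eventually_pow_size_le : ∀ᶠ v : ℕ in Filter.atTop,
    (v : ℝ) ^ (v.size + 1) ≤ Real.exp (v / 1000) := by
  have hlog := (Real.isLittleO_pow_log_id_atTop (n := 2)).bound (show (0 : ℝ) < 1 / 4000 by norm_num)
  filter_upwards [tendsto_natCast_atTop_atTop.eventually hlog, Filter.eventually_ge_atTop 3]
    with v hv h3
  have h3' : (3 : ℝ) ≤ v := by exact_mod_cast h3
  have hv0 : (0 : ℝ) < v := by linarith
  have hone : 1 ≤ Real.log v := by
    rw [Real.le_log_iff_exp_le hv0]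
    linarith [Real.exp_one_lt_d9]
  have hsize : (v.size : ℝ) ≤ 2 * Real.log v + 1 := by
    have hpos : 0 < v.size := Nat.size_pos.2 (by omega)
    have h : 2 ^ (v.size - 1) ≤ v := Nat.lt_size.1 (by omega)
    have h' : (2 : ℝ) ^ (v.size - 1) ≤ v := by exact_mod_cast h
    have hl := Real.log_le_log (by positivity) h'
    rw [Real.log_pow, Nat.cast_sub hpos, Nat.cast_one] at hl
    have h1 : (1 : ℝ) ≤ v.size := by exact_mod_cast hpos
    nlinarith [Real.log_two_gt_d9]
  rw [Real.norm_of_nonneg (by positivity), id, Real.norm_of_nonneg hv0.le] at hv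
  rw [← Real.exp_log (pow_pos hv0 _), Real.log_pow, Real.exp_le_exp]
  push_cast
  nlinarith

lemma exp_le_pow (q : ℕ) : Real.exp (q / 8) ≤ 1.15 ^ q := by
  have h : Real.exp (1 / 8) ≤ 1.15 := by
    refine le_of_pow_le_pow_left₀ (n := 8) (by norm_num) (by norm_num) ?_
    rw [← Real.exp_nat_mul]
    norm_num
    linarith [Real.exp_one_lt_d9]
  calc Real.exp (q / 8) = Real.exp (1 / 8) ^ q := by
        rw [← Real.exp_nat_mul]
        ring_nf
    _ ≤ 1.15 ^ q := by gcongr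

lemma pow_le_exp (r : ℕ) : (2.49 : ℝ) ^ r ≤ Real.exp r := by
  rw [← Real.exp_one_pow]
  gcongr
  linarith [Real.exp_one_gt_d9]

lemma eventually_pow_le_NC :
    ∀ᶠ n : ℕ in Filter.atTop, (2.49 : ℝ) ^ n ≤ (NC (6 * n + 3) 3 : ℝ) := by
  have htend : Filter.Tendsto (fun n : ℕ => 6 * n + 3) Filter.atTop Filter.atTop :=
    Filter.tendsto_atTop_mono (fun n => by dsimp only [id]; omega) Filter.tendsto_id
  filter_upwards [htend.eventually eventually_pow_size_le, Filter.eventually_ge_atTop 4000]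
    with n hn hlarge
  obtain ⟨S, q, hS, hr, rfl⟩ := exists_starter n (by omega)
  have hcard := (hS.card_le q).trans
    ((card_rotations_le (v := 6 * (12 * q + S.r) + 3)).trans
      (card_cyclicDesign_le (Nat.lt_size_self _)))
  set v := 6 * (12 * q + S.r) + 3 with hv
  have hcard' : (65536 : ℝ) ^ q ≤ NC v 3 * (v : ℝ) ^ (v.size + 1) := by exact_mod_cast hcard
  have hr' : (S.r : ℝ) ≤ 16 := by exact_mod_cast hr
  have hq : (304 : ℝ) ≤ q := by
    have : 304 ≤ q := by omega
    exact_mod_cast this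
  have hpos : (0 : ℝ) < (v : ℝ) ^ (v.size + 1) := by positivity
  have hsmall : (2.49 : ℝ) ^ S.r * (v : ℝ) ^ (v.size + 1) ≤ 1.15 ^ q :=
    calc (2.49 : ℝ) ^ S.r * (v : ℝ) ^ (v.size + 1)
        ≤ Real.exp S.r * Real.exp (v / 1000) := by
          gcongr
          exact pow_le_exp _
      _ = Real.exp (S.r + v / 1000) := (Real.exp_add _ _).symm
      _ ≤ Real.exp (q / 8) := by
          rw [Real.exp_le_exp, hv]
          push_cast
          linarith
      _ ≤ 1.15 ^ q := exp_le_pow q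
  refine le_of_mul_le_mul_right ?_ hpos
  calc (2.49 : ℝ) ^ (12 * q + S.r) * (v : ℝ) ^ (v.size + 1)
      = (2.49 ^ 12) ^ q * ((2.49 : ℝ) ^ S.r * (v : ℝ) ^ (v.size + 1)) := by
        rw [pow_add, pow_mul, mul_assoc]
    _ ≤ (2.49 ^ 12) ^ q * 1.15 ^ q := by gcongr
    _ = (2.49 ^ 12 * 1.15) ^ q := (mul_pow _ _ _).symm
    _ ≤ 65536 ^ q := by
        gcongr
        norm_num
    _ ≤ NC v 3 * (v : ℝ) ^ (v.size + 1) := hcard'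

end Asymptotics

end CCS

/-- For all sufficiently large `n` not congruent to `3, 5, 24, 26 (mod 28)`,
`NC(6n+3, 3) ≥ 2.49^n`. -/
theorem stmt5 : ∃ N : ℕ, ∀ n : ℕ, N ≤ n →
    ¬(n % 28 = 3 ∨ n % 28 = 5 ∨ n % 28 = 24 ∨ n % 28 = 26) →
    (2.49 : ℝ) ^ n ≤ (CCS.NC (6 * n + 3) 3 : ℝ) := by
  obtain ⟨N, hN⟩ := Filter.eventually_atTop.1 CCS.eventually_pow_le_NC
  exact ⟨N, fun n hn _ => hN n hn⟩
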